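/- arXiv:2409.11328 — 3 statements merged into one kernel-verified Lean document; each statement's English description precedes it below -/
import Mathlib

section
/- Let G be a graph on n vertices. If Δ(G) ≤ n − 2, then b_g(G) ≤ n − Δ(G); and if Δ(G) ≤ n − 3, then b_g'(G) ≤ n − Δ(G). -/
namespace BurningGame

/-- One spreading phase: all neighbors of burned vertices become burned. -/
noncomputable def spread {V : Type*} [Fintype V] [DecidableEq V] (G : SimpleGraph V) (B : Finset V) : Finset V :=
  ((↑B : Set V) ∪ {v | ∃ u ∈ B, G.Adj u v}).toFinite.toFinset

/-- `EndBy G turn i B k`: starting from burned set `B` at round index `i`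
(the player selecting in round `i` is Burner iff `turn i = true`; Burner's selections are
quantified existentially, Staller's universally), Burner can force the game to end
within `k` further rounds. -/
def EndBy {V : Type*} [Fintype V] [DecidableEq V] (G : SimpleGraph V) (turn : ℕ → Bool) :
    ℕ → Finset V → ℕ → Prop
  | _, B, 0 => B = Finset.univ
  | i, B, k + 1 => B = Finset.univ ∨
      spread G B = Finset.univ ∨
      (if turn i then ∃ v ∉ spread G B, EndBy G turn (i + 1) (insert v (spread G B)) k
       else ∀ v ∉ spread G B, EndBy G turn (i + 1) (insert v (spread G B)) k)

/-- Game burning number relative to a preburned set `S` (Burner starts). -/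
noncomputable def bgRel {V : Type*} [Fintype V] [DecidableEq V] (G : SimpleGraph V) (S : Finset V) : ℕ :=
  sInf {k | EndBy G (fun i => i % 2 == 0) 0 S k}

/-- The game burning number (Burner starts). -/
noncomputable def bg {V : Type*} [Fintype V] [DecidableEq V] (G : SimpleGraph V) : ℕ := bgRel G ∅

/-- The Staller-start game burning number. -/
noncomputable def bg' {V : Type*} [Fintype V] [DecidableEq V] (G : SimpleGraph V) : ℕ :=
  sInf {k | EndBy G (fun i => i % 2 == 1) 0 ∅ k}

/-- The burning number: only Burner plays. -/
noncomputable def burn {V : Type*} [Fintype V] [DecidableEq V] (G : SimpleGraph V) : ℕ :=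
  sInf {k | EndBy G (fun _ => true) 0 ∅ k}

/-- The cooling number: only Staller plays. -/
noncomputable def cool {V : Type*} [Fintype V] [DecidableEq V] (G : SimpleGraph V) : ℕ :=
  sInf {k | EndBy G (fun _ => false) 0 ∅ k}


section Auxiliary

variable {V : Type*} [Fintype V] [DecidableEq V] (G : SimpleGraph V)

theorem mem_spread {B : Finset V} {v : V} :
    v ∈ spread G B ↔ v ∈ B ∨ ∃ u ∈ B, G.Adj u v := by
  simp [spread]

theorem subset_spread (B : Finset V) : B ⊆ spread G B :=
  fun _ hv => (mem_spread G).2 (Or.inl hv)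

/-- The closed neighborhood of a burned vertex is burned after spreading. -/
theorem insert_neighborFinset_subset_spread [DecidableRel G.Adj] {B : Finset V} {v : V}
    (hv : v ∈ B) : insert v (G.neighborFinset v) ⊆ spread G B := by
  intro x hx
  rcases Finset.mem_insert.1 hx with rfl | hx
  · exact subset_spread G B hv
  · exact (mem_spread G).2 (Or.inr ⟨v, hv, (G.mem_neighborFinset v x).1 hx⟩)

theorem endBy_succ_of_forall {turn : ℕ → Bool} {k i : ℕ} {B : Finset V}
    (h : ∀ v ∉ spread G B, EndBy G turn (i + 1) (insert v (spread G B)) k) :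
    EndBy G turn i B (k + 1) := by
  by_cases hs : spread G B = Finset.univ
  · exact Or.inr (Or.inl hs)
  refine Or.inr (Or.inr ?_)
  split_ifs
  · obtain ⟨v, hv⟩ : ∃ v, v ∉ spread G B := by
      simpa [Finset.eq_univ_iff_forall] using hs
    exact ⟨v, hv, h v hv⟩
  · exact h

/-- Every move burns a new vertex, so the game ends after at most as many rounds as there are
unburned vertices. -/
theorem endBy_of_card_le (turn : ℕ → Bool) (k i : ℕ) (B : Finset V)
    (h : Fintype.card V ≤ B.card + k) : EndBy G turn i B k := by
  induction k generalizing i B with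
  | zero => exact Finset.eq_univ_of_card B (le_antisymm (Finset.card_le_univ B) h)
  | succ k ih =>
    refine endBy_succ_of_forall G fun v hv => ih _ _ ?_
    have := Finset.card_le_card (subset_spread G B)
    rw [Finset.card_insert_of_notMem hv]
    omega

theorem endBy_succ_of_card_spread_le (turn : ℕ → Bool) (k i : ℕ) (B : Finset V)
    (h : Fintype.card V ≤ (spread G B).card + (k + 1)) : EndBy G turn i B (k + 1) := by
  refine endBy_succ_of_forall G fun v hv => endBy_of_card_le G _ _ _ _ ?_
  rw [Finset.card_insert_of_notMem hv]
  omega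

theorem card_insert_neighborFinset [DecidableRel G.Adj] (v : V) :
    (insert v (G.neighborFinset v)).card = G.degree v + 1 := by
  rw [Finset.card_insert_of_notMem (by simp), G.card_neighborFinset_eq_degree]

/-- Burner opens with the vertex `v`. -/
theorem endBy_of_burner_start [DecidableRel G.Adj] (v : V) (m : ℕ)
    (h : Fintype.card V ≤ G.degree v + (m + 2)) :
    EndBy G (fun i => i % 2 == 0) 0 ∅ (m + 2) := by
  refine Or.inr (Or.inr ?_)
  rw [if_pos (by decide)]
  refine ⟨v, by simp [mem_spread], endBy_succ_of_card_spread_le G _ m _ _ ?_⟩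
  have := Finset.card_le_card
    (insert_neighborFinset_subset_spread G (Finset.mem_insert_self v (spread G ∅)))
  rw [card_insert_neighborFinset] at this
  omega

/-- After any first move of Staller, Burner can answer so that after the next spreading phase
either everything or at least `G.degree v + 2` vertices are burned. -/
theorem exists_burner_reply [DecidableRel G.Adj] (v : V) {B : Finset V} (hB : B.Nonempty)
    (hs : spread G B ≠ Finset.univ) :
    ∃ w ∉ spread G B, spread G (insert w (spread G B)) = Finset.univ ∨
      G.degree v + 2 ≤ (spread G (insert w (spread G B))).card := by
  have enough : ∀ w x, v ∈ insert w (spread G B) → x ∈ insert w (spread G B) →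
      x ∉ insert v (G.neighborFinset v) →
      G.degree v + 2 ≤ (spread G (insert w (spread G B))).card := by
    intro w x hv hx hxv
    have := Finset.card_le_card (Finset.insert_subset (subset_spread G _ hx)
      (insert_neighborFinset_subset_spread G hv))
    rwa [Finset.card_insert_of_notMem hxv, card_insert_neighborFinset] at this
  by_cases hv : v ∈ spread G B
  · by_cases hw : ∃ w ∉ spread G B, w ∉ insert v (G.neighborFinset v)
    · obtain ⟨w, hw, hwv⟩ := hw
      exact ⟨w, hw, Or.inr (enough w w (Finset.mem_insert_of_mem hv)
        (Finset.mem_insert_self _ _) hwv)⟩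
    · obtain ⟨w, hwB⟩ : ∃ w, w ∉ spread G B := by
        simpa [Finset.eq_univ_iff_forall] using hs
      refine ⟨w, hwB, Or.inl (Finset.eq_univ_of_forall fun x => ?_)⟩
      by_cases hx : x ∈ spread G B
      · exact subset_spread G _ (Finset.mem_insert_of_mem hx)
      · refine insert_neighborFinset_subset_spread G (Finset.mem_insert_of_mem hv) ?_
        by_contra hxv
        exact hw ⟨x, hx, hxv⟩
  · obtain ⟨u, hu⟩ := hB
    refine ⟨v, hv, Or.inr (enough v u (Finset.mem_insert_self _ _)
      (Finset.mem_insert_of_mem (subset_spread G _ hu)) fun huv => hv ?_)⟩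
    rcases Finset.mem_insert.1 huv with rfl | huv
    · exact subset_spread G _ hu
    · exact (mem_spread G).2 (Or.inr ⟨u, hu, ((G.mem_neighborFinset v u).1 huv).symm⟩)

theorem endBy_of_staller_start [DecidableRel G.Adj] (v : V) (m : ℕ)
    (h : Fintype.card V ≤ G.degree v + (m + 3)) :
    EndBy G (fun i => i % 2 == 1) 0 ∅ (m + 3) := by
  refine Or.inr (Or.inr ?_)
  rw [if_neg (by decide)]
  intro u _
  by_cases hs : spread G (insert u (spread G ∅)) = Finset.univ
  · exact Or.inr (Or.inl hs)
  obtain ⟨w, hw, hend⟩ := exists_burner_reply G v (Finset.insert_nonempty u (spread G ∅)) hs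
  refine Or.inr (Or.inr ?_)
  rw [if_pos (by decide)]
  refine ⟨w, hw, ?_⟩
  rcases hend with hend | hcard
  · exact Or.inr (Or.inl hend)
  · exact endBy_succ_of_card_spread_le G _ m _ _ (by omega)

end Auxiliary

theorem stmt2 {V : Type*} [Fintype V] [DecidableEq V] (G : SimpleGraph V)
    [DecidableRel G.Adj] :
    (G.maxDegree ≤ Fintype.card V - 2 → bg G ≤ Fintype.card V - G.maxDegree) ∧
    (G.maxDegree ≤ Fintype.card V - 3 → bg' G ≤ Fintype.card V - G.maxDegree) := by
  rcases Nat.eq_zero_or_pos G.maxDegree with h0 | hpos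
  · rw [h0]
    exact ⟨fun _ => Nat.sInf_le (endBy_of_card_le G _ _ 0 ∅ (by simp)),
      fun _ => Nat.sInf_le (endBy_of_card_le G _ _ 0 ∅ (by simp))⟩
  have hne : Nonempty V := by
    by_contra hV
    rw [not_nonempty_iff] at hV
    simp at hpos
  obtain ⟨v, hv⟩ := G.exists_maximal_degree_vertex
  constructor
  · intro h
    obtain ⟨m, hm⟩ : ∃ m, Fintype.card V - G.maxDegree = m + 2 :=
      ⟨Fintype.card V - G.maxDegree - 2, by omega⟩
    rw [hm]
    exact Nat.sInf_le (endBy_of_burner_start G v m (by omega))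
  · intro h
    obtain ⟨m, hm⟩ : ∃ m, Fintype.card V - G.maxDegree = m + 3 :=
      ⟨Fintype.card V - G.maxDegree - 3, by omega⟩
    rw [hm]
    exact Nat.sInf_le (endBy_of_staller_start G v m (by omega))

end BurningGame
end

section
/- For a connected graph G, b_g(G) = 2 if and only if G ≠ K₁ and Δ(G) ≥ |V(G)| − 2. -/
namespace BurningGame

theorem spread_empty {V : Type*} [Fintype V] [DecidableEq V] (G : SimpleGraph V) :
    spread G ∅ = ∅ := by
  simp [spread]

theorem spread_singleton {V : Type*} [Fintype V] [DecidableEq V] (G : SimpleGraph V)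
    [DecidableRel G.Adj] (v : V) : spread G {v} = insert v (G.neighborFinset v) := by
  ext w
  simp [spread]

theorem card_spread_singleton {V : Type*} [Fintype V] [DecidableEq V] (G : SimpleGraph V)
    [DecidableRel G.Adj] (v : V) : (spread G {v}).card = G.degree v + 1 := by
  rw [spread_singleton, Finset.card_insert_of_notMem (by simp), SimpleGraph.card_neighborFinset_eq_degree]

theorem endBy_empty_one_iff {V : Type*} [Fintype V] [DecidableEq V] [Nonempty V]
    (G : SimpleGraph V) :
    EndBy G (fun i => i % 2 == 0) 0 ∅ 1 ↔ Fintype.card V = 1 := by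
  have h : (∅ : Finset V) ≠ Finset.univ := Finset.univ_nonempty.ne_empty.symm
  simp only [EndBy, spread_empty, h, false_or, Finset.notMem_empty, not_false_eq_true,
    true_and, insert_empty_eq]
  simp only [Nat.zero_mod, beq_self_eq_true, if_true]
  constructor
  · rintro ⟨v, hv⟩
    rw [← Finset.card_univ, ← hv, Finset.card_singleton]
  · intro hc
    obtain ⟨v⟩ := ‹Nonempty V›
    exact ⟨v, Finset.eq_univ_of_card _ (by simp [hc])⟩

theorem endBy_empty_two_iff {V : Type*} [Fintype V] [DecidableEq V] [Nonempty V]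
    (G : SimpleGraph V) [DecidableRel G.Adj] :
    EndBy G (fun i => i % 2 == 0) 0 ∅ 2 ↔ ∃ v, Fintype.card V ≤ G.degree v + 2 := by
  have h : (∅ : Finset V) ≠ Finset.univ := Finset.univ_nonempty.ne_empty.symm
  simp only [EndBy, spread_empty, h, false_or, Finset.notMem_empty, not_false_eq_true,
    true_and, insert_empty_eq]
  simp only [Nat.zero_mod, beq_self_eq_true, if_true]
  refine exists_congr fun v => ?_
  have hs := card_spread_singleton G v
  have key : ∀ w ∉ spread G {v}, (insert w (spread G {v})).card = G.degree v + 2 := by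
    intro w hw
    rw [Finset.card_insert_of_notMem hw, hs]
  constructor
  · rintro (hv | hv | hv)
    · rw [← Finset.card_univ, ← hv, Finset.card_singleton]
      omega
    · rw [← Finset.card_univ, ← hv, hs]
      omega
    · by_cases hu : spread G {v} = Finset.univ
      · rw [← Finset.card_univ, ← hu, hs]
        omega
      · obtain ⟨w, hw⟩ : ∃ w, w ∉ spread G {v} := by
          simpa [Finset.eq_univ_iff_forall] using hu
        rw [← key w hw, ← Finset.card_univ]
        simp only [zero_add, Nat.one_mod, Nat.reduceBEq, Bool.false_eq_true, if_false] at hv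
        rw [hv w hw]
  · intro hc
    refine Or.inr (Or.inr ?_)
    simp only [zero_add, Nat.one_mod, Nat.reduceBEq, Bool.false_eq_true, if_false]
    intro w hw
    apply Finset.eq_univ_of_card
    have := Finset.card_le_univ (insert w (spread G {v}))
    rw [key w hw] at this ⊢
    omega

theorem stmt7 {V : Type*} [Fintype V] [DecidableEq V] (G : SimpleGraph V)
    [DecidableRel G.Adj] (hG : G.Connected) :
    bg G = 2 ↔ (2 ≤ Fintype.card V ∧ Fintype.card V - 2 ≤ G.maxDegree) := by
  have := hG.nonempty
  have h0 : ¬ EndBy G (fun i => i % 2 == 0) 0 ∅ 0 := Finset.univ_nonempty.ne_empty.symm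
  have h1 := endBy_empty_one_iff G
  have h2 := endBy_empty_two_iff G
  have hpos : 0 < Fintype.card V := Fintype.card_pos
  unfold bg bgRel
  constructor
  · intro hb
    have hmem := Nat.sInf_mem (Nat.nonempty_of_pos_sInf (by rw [hb]; norm_num))
    rw [hb] at hmem
    obtain ⟨v, hv⟩ := h2.1 hmem
    have hn : ¬ EndBy G (fun i => i % 2 == 0) 0 ∅ 1 :=
      Nat.notMem_of_lt_sInf (hb ▸ Nat.one_lt_two)
    have := G.degree_le_maxDegree v
    rw [h1] at hn
    omega
  · rintro ⟨hc, hd⟩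
    obtain ⟨v, hv⟩ := G.exists_maximal_degree_vertex
    have hmem := h2.2 ⟨v, by omega⟩
    refine le_antisymm (Nat.sInf_le hmem) (le_csInf ⟨2, hmem⟩ fun k hk => ?_)
    by_contra! hlt
    interval_cases k
    · exact h0 hk
    · have := h1.1 hk
      omega

end BurningGame
end

section
/- For a connected graph G, b_g'(G) = 2 if and only if G ≠ K₁ and δ(G) ≥ |V(G)| − 2. -/
namespace BurningGame

/-- A set is everything, possibly after adding one element, iff it misses at most one element. -/
theorem eq_univ_or_exists_insert_eq_univ_iff {V : Type*} [Fintype V] [DecidableEq V]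
    (s : Finset V) :
    (s = Finset.univ ∨ ∃ w ∉ s, insert w s = Finset.univ) ↔ Fintype.card V ≤ s.card + 1 := by
  constructor
  · rintro (rfl | ⟨w, -, h⟩)
    · simp
    · rw [← Finset.card_univ, ← h]
      exact Finset.card_insert_le w s
  · intro h
    by_cases hs : s = Finset.univ
    · exact Or.inl hs
    · obtain ⟨w, hw⟩ : ∃ w, w ∉ s := by simpa [Finset.eq_univ_iff_forall] using hs
      refine Or.inr ⟨w, hw, Finset.eq_univ_of_card _ (le_antisymm (Finset.card_le_univ _) ?_)⟩
      rwa [Finset.card_insert_of_notMem hw]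

/-- Burner can finish in one round after `v` is burned iff `v` has at most one non-neighbor. -/
theorem endBy_one_singleton_iff {V : Type*} [Fintype V] [DecidableEq V] (G : SimpleGraph V)
    [DecidableRel G.Adj] (turn : ℕ → Bool) (i : ℕ) (hi : turn i = true) (v : V) :
    EndBy G turn i {v} 1 ↔ Fintype.card V - 2 ≤ G.degree v := by
  have key := eq_univ_or_exists_insert_eq_univ_iff (spread G {v})
  rw [card_spread_singleton] at key
  simp only [EndBy, hi, if_true]
  rw [key]
  constructor
  · rintro (h | h)
    · have := congrArg Finset.card h
      simp only [Finset.card_singleton, Finset.card_univ] at this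
      omega
    · omega
  · intro h
    exact Or.inr (by omega)

/-- When Staller moves first, one additional round is needed beyond those after the first move. -/
theorem endBy_succ_empty_iff {V : Type*} [Fintype V] [DecidableEq V] [Nonempty V]
    (G : SimpleGraph V) (turn : ℕ → Bool) (i : ℕ) (hi : turn i = false) (k : ℕ) :
    EndBy G turn i ∅ (k + 1) ↔ ∀ v, EndBy G turn (i + 1) {v} k := by
  have hne : (∅ : Finset V) ≠ Finset.univ := Finset.univ_nonempty.ne_empty.symm
  simp [EndBy, spread_empty, hi, hne]

theorem stmt8 {V : Type*} [Fintype V] [DecidableEq V] (G : SimpleGraph V)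
    [DecidableRel G.Adj] (hG : G.Connected) :
    bg' G = 2 ↔ (2 ≤ Fintype.card V ∧ Fintype.card V - 2 ≤ G.minDegree) := by
  have : Nonempty V := hG.nonempty
  have h0 : ¬ EndBy G (fun i => i % 2 == 1) 0 ∅ 0 := fun h =>
    Finset.univ_nonempty.ne_empty (by simpa only [EndBy] using h.symm)
  have h1 : EndBy G (fun i => i % 2 == 1) 0 ∅ 1 ↔ Fintype.card V = 1 := by
    rw [endBy_succ_empty_iff G _ 0 rfl]
    simp only [EndBy, ← Finset.card_eq_iff_eq_univ, Finset.card_singleton, forall_const]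
    exact eq_comm
  have h2 : EndBy G (fun i => i % 2 == 1) 0 ∅ 2 ↔ Fintype.card V - 2 ≤ G.minDegree := by
    rw [endBy_succ_empty_iff G _ 0 rfl]
    simp only [endBy_one_singleton_iff G (fun i => i % 2 == 1) (0 + 1) rfl]
    exact ⟨G.le_minDegree_of_forall_le_degree _, fun h v => h.trans (G.minDegree_le_degree v)⟩
  have hpos : 0 < Fintype.card V := Fintype.card_pos
  rw [← h2]
  constructor
  · intro h
    have hmem := Nat.sInf_mem (Nat.nonempty_of_pos_sInf (h.symm ▸ two_pos : 0 < bg' G))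
    change EndBy G _ 0 ∅ (bg' G) at hmem
    rw [h] at hmem
    refine ⟨?_, hmem⟩
    by_contra hlt
    have : bg' G ≤ 1 := Nat.sInf_le (h1.2 (by omega))
    omega
  · rintro ⟨hcard, h⟩
    refine le_antisymm (Nat.sInf_le h) (le_csInf ⟨2, h⟩ fun k hk => ?_)
    match k, hk with
    | 0, hk => exact absurd hk h0
    | 1, hk => have := h1.1 hk; omega
    | k + 2, _ => omega

end BurningGame
end
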